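/- arXiv:2411.06234 — 3 statements merged into one kernel-verified Lean document; each statement's English description precedes it below -/
import Mathlib

section
/- Let K ≥ 0, let λ : Fin 2 → ℝ with λ i > 0, let α : Fin 2 → ℂ, and let N : Fin 2 → Fin 2 → Fin 2 → ℂ satisfy N i j k = −N i k j and |N i j k| ≤ K for all i, j, k. Then |Σ_{h,j,k,q ∈ Fin 2} (λ j)⁻¹ · (λ q)⁻¹ · α j · conj(α h) · N k q j · conj(N h k q)| ≤ 8 K² · (λ 0 · λ 1)⁻¹ · Σ_{h ∈ Fin 2} |α h|². -/
lemma eq_zero_of_skew {N : Fin 2 → Fin 2 → Fin 2 → ℂ}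
    (hskew : ∀ i j k, N i j k = - N i k j) (i j : Fin 2) : N i j j = 0 :=
  self_eq_neg.mp (hskew i j j)

lemma inv_mul_inv_of_ne (l : Fin 2 → ℝ) {j q : Fin 2} (hjq : j ≠ q) :
    (l j)⁻¹ * (l q)⁻¹ = (l 0 * l 1)⁻¹ := by
  fin_cases j <;> fin_cases q <;> simp_all [mul_comm]

lemma norm_mul_norm_le_sum_sq {ι : Type*} [Fintype ι] (a : ι → ℂ) (j h : ι) :
    ‖a j‖ * ‖a h‖ ≤ ∑ i, ‖a i‖ ^ 2 := by
  have le_sum (i : ι) : ‖a i‖ ^ 2 ≤ ∑ i, ‖a i‖ ^ 2 :=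
    Finset.single_le_sum (f := fun i => ‖a i‖ ^ 2) (fun _ _ => sq_nonneg _) (Finset.mem_univ i)
  nlinarith [le_sum j, le_sum h, sq_nonneg (‖a j‖ - ‖a h‖)]

lemma norm_nijenhuis_summand_le
    {K : ℝ} {l : Fin 2 → ℝ} (hl : ∀ i, 0 < l i) (a : Fin 2 → ℂ)
    {N : Fin 2 → Fin 2 → Fin 2 → ℂ}
    (hskew : ∀ i j k, N i j k = - N i k j)
    (hbd : ∀ i j k, ‖N i j k‖ ≤ K) (h j k q : Fin 2) :
    ‖(((l j)⁻¹ * (l q)⁻¹ : ℝ) : ℂ) * a j * (starRingEnd ℂ) (a h)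
        * N k q j * (starRingEnd ℂ) (N h k q)‖
      ≤ if j = q then 0 else K ^ 2 * (l 0 * l 1)⁻¹ * ∑ i : Fin 2, ‖a i‖ ^ 2 := by
  split_ifs with hjq
  · subst hjq
    simp [eq_zero_of_skew hskew]
  · have hc : 0 ≤ (l 0 * l 1)⁻¹ := (inv_pos.mpr (mul_pos (hl 0) (hl 1))).le
    have hK : 0 ≤ K := (norm_nonneg _).trans (hbd 0 0 0)
    rw [inv_mul_inv_of_ne l hjq]
    simp only [norm_mul, RCLike.norm_conj, Complex.norm_real, Real.norm_of_nonneg hc]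
    calc (l 0 * l 1)⁻¹ * ‖a j‖ * ‖a h‖ * ‖N k q j‖ * ‖N h k q‖
        = (‖N k q j‖ * ‖N h k q‖) * (l 0 * l 1)⁻¹ * (‖a j‖ * ‖a h‖) := by ring
      _ ≤ (K * K) * (l 0 * l 1)⁻¹ * ∑ i : Fin 2, ‖a i‖ ^ 2 := by
          gcongr
          · exact hbd k q j
          · exact hbd h k q
          · exact norm_mul_norm_le_sum_sq a j h
      _ = K ^ 2 * (l 0 * l 1)⁻¹ * ∑ i : Fin 2, ‖a i‖ ^ 2 := by ring

/-- Pointwise bound for the Nijenhuis curvature term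
`−4 α̃_j conj(α̃_h) Ñ^k_{q̄ j̄} conj(Ñ^h_{k̄ q̄})`. -/
theorem nijenhuis_term_bound
    (K : ℝ) (hK : 0 ≤ K)
    (l : Fin 2 → ℝ) (hl : ∀ i, 0 < l i)
    (a : Fin 2 → ℂ)
    (N : Fin 2 → Fin 2 → Fin 2 → ℂ)
    (hskew : ∀ i j k, N i j k = - N i k j)
    (hbd : ∀ i j k, ‖N i j k‖ ≤ K) :
    ‖∑ h : Fin 2, ∑ j : Fin 2, ∑ k : Fin 2, ∑ q : Fin 2,
        (((l j)⁻¹ * (l q)⁻¹ : ℝ) : ℂ) * a j * (starRingEnd ℂ) (a h)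
          * N k q j * (starRingEnd ℂ) (N h k q)‖
      ≤ 8 * K ^ 2 * (l 0 * l 1)⁻¹ * ∑ h : Fin 2, ‖a h‖ ^ 2 := by
  refine (norm_sum_le_of_le _ fun h _ => norm_sum_le_of_le _ fun j _ =>
    norm_sum_le_of_le _ fun k _ => norm_sum_le_of_le _ fun q _ =>
      norm_nijenhuis_summand_le hl a hskew hbd h j k q).trans (le_of_eq ?_)
  generalize ∑ i : Fin 2, ‖a i‖ ^ 2 = S
  simp only [Fin.sum_univ_two, Fin.isValue, ↓reduceIte, zero_ne_one, one_ne_zero]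
  ring
end

section
/- For every K ≥ 0 and B ≥ 1 there exists a constant C > 0 (depending only on K and B) with the following property: for all λ : Fin 2 → ℝ with λ i > 0 and B⁻¹ ≤ λ 0 · λ 1 ≤ B, all M : Matrix (Fin 2) (Fin 2) ℂ, all α : Fin 2 → ℂ, and all N : Fin 2 → Fin 2 → Fin 2 → ℂ with N i j k = −N i k j and |N i j k| ≤ K, one has 4 · (λ 0 · λ 1)⁻¹ · |Σ_{i,j,k ∈ Fin 2} M i j · α k · N j k i| ≤ (1/2) · Σ_{i,j ∈ Fin 2} (λ i)⁻¹ (λ j)⁻¹ |M i j|² + C · (λ 0 + λ 1) · Σ_{k ∈ Fin 2} (λ k)⁻¹ |α k|². -/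
/-- Weighted arithmetic-geometric mean inequality for a single component of the gradient term. -/
theorem gradient_component_bound {K B x y z m a : ℝ} (hx : 0 < x) (hy : 0 < y) (hz : 0 < z)
    (hB : (x * z)⁻¹ ≤ B) :
    4 * (x * z)⁻¹ * (m * a * K) ≤
      (1 / 2) * (x⁻¹ * y⁻¹ * m ^ 2) + 8 * K ^ 2 * B * y * (z⁻¹ * a ^ 2) := by
  have hsq : 0 ≤ 1 / 2 * (x⁻¹ * y⁻¹) * (m - 4 * K * y * z⁻¹ * a) ^ 2 := by positivity
  have hsq_eq : 1 / 2 * (x⁻¹ * y⁻¹) * (m - 4 * K * y * z⁻¹ * a) ^ 2 =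
      1 / 2 * (x⁻¹ * y⁻¹ * m ^ 2) - 4 * (x * z)⁻¹ * (m * a * K) +
        8 * K ^ 2 * y * (z⁻¹ * a ^ 2) * (x * z)⁻¹ := by
    field_simp
    ring
  have hle : 8 * K ^ 2 * y * (z⁻¹ * a ^ 2) * (x * z)⁻¹ ≤
      8 * K ^ 2 * y * (z⁻¹ * a ^ 2) * B := by gcongr
  linarith


/-- The estimate `−Re(4 α̃_{i,j} α̃_k Ñ^j_{k̄ī}) ≤ ½|α̃_{i,j}|² + C tr_g g̃ |α|²_{g̃}`. -/
theorem gradient_term_bound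
    (K B : ℝ) (hK : 0 ≤ K) (hB : 1 ≤ B) :
    ∃ C > 0, ∀ (l : Fin 2 → ℝ), (∀ i, 0 < l i) →
      B⁻¹ ≤ l 0 * l 1 → l 0 * l 1 ≤ B →
      ∀ (M : Matrix (Fin 2) (Fin 2) ℂ) (a : Fin 2 → ℂ)
        (N : Fin 2 → Fin 2 → Fin 2 → ℂ),
        (∀ i j k, N i j k = - N i k j) →
        (∀ i j k, ‖N i j k‖ ≤ K) →
        4 * (l 0 * l 1)⁻¹ *
            ‖∑ i : Fin 2, ∑ j : Fin 2, ∑ k : Fin 2, M i j * a k * N j k i‖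
          ≤ (1 / 2) * (∑ i : Fin 2, ∑ j : Fin 2, (l i)⁻¹ * (l j)⁻¹ * ‖M i j‖ ^ 2)
            + C * (l 0 + l 1) * ∑ k : Fin 2, (l k)⁻¹ * ‖a k‖ ^ 2 := by
  refine ⟨8 * K ^ 2 * B + 1, by positivity, fun l hl hlB _ M a N hskew hN => ?_⟩
  have hdiag (i j : Fin 2) : N i j j = 0 := self_eq_neg.mp (hskew i j j)
  have hterm (i j k : Fin 2) : ‖M i j * a k * N j k i‖ ≤ ‖M i j‖ * ‖a k‖ * K := by
    rw [norm_mul, norm_mul]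
    gcongr
    exact hN j k i
  have hinv : (l 0 * l 1)⁻¹ ≤ B :=
    inv_le_of_inv_le₀ (by linarith) hlB
  have hinv_symm : (l 1 * l 0)⁻¹ ≤ B := by rwa [mul_comm]
  have hsum : ‖∑ i : Fin 2, ∑ j : Fin 2, ∑ k : Fin 2, M i j * a k * N j k i‖ ≤
      (‖M 0 0‖ * ‖a 1‖ * K + ‖M 0 1‖ * ‖a 1‖ * K) +
        (‖M 1 0‖ * ‖a 0‖ * K + ‖M 1 1‖ * ‖a 0‖ * K) := by
    simp only [Fin.sum_univ_two, hdiag, mul_zero, zero_add, add_zero]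
    exact norm_add_le_of_le (norm_add_le_of_le (hterm _ _ _) (hterm _ _ _))
      (norm_add_le_of_le (hterm _ _ _) (hterm _ _ _))
  have hl0 := hl 0
  have hl1 := hl 1
  have hmul := mul_le_mul_of_nonneg_left hsum
    (show 0 ≤ 4 * (l 0 * l 1)⁻¹ by positivity)
  have h00 := gradient_component_bound (K := K) (m := ‖M 0 0‖) (a := ‖a 1‖) hl0 hl0 hl1 hinv
  have h01 := gradient_component_bound (K := K) (m := ‖M 0 1‖) (a := ‖a 1‖) hl0 hl1 hl1 hinv
  have h10 := gradient_component_bound (K := K) (m := ‖M 1 0‖) (a := ‖a 0‖) hl1 hl0 hl0 hinv_symm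
  have h11 := gradient_component_bound (K := K) (m := ‖M 1 1‖) (a := ‖a 0‖) hl1 hl1 hl0 hinv_symm
  rw [mul_comm (l 1) (l 0)] at h10 h11
  have htrace : 0 ≤ (l 0 + l 1) * ((l 0)⁻¹ * ‖a 0‖ ^ 2 + (l 1)⁻¹ * ‖a 1‖ ^ 2) := by positivity
  simp only [Fin.sum_univ_two] at hmul ⊢
  linarith
end

section
/- Let K ≥ 0, let α : Fin 2 → ℂ, let N : Fin 2 → Fin 2 → Fin 2 → ℂ satisfy N i j k = −N i k j and |N i j k| ≤ K for all indices, and let R : Fin 2 → Fin 2 → Fin 2 → ℂ. Then |Σ_{i,t,j,k ∈ Fin 2} α i · α k · N t j k · R i t j| ≤ 4 K · (Σ_{h ∈ Fin 2} |α h|²) · ((Σ_{i,t,j ∈ Fin 2} |R i t j|²))^{1/2}. -/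
theorem norm_le_sqrt_sum_sq {ι κ τ E : Type*} [Fintype ι] [Fintype κ] [Fintype τ]
    [SeminormedAddGroup E] (R : ι → κ → τ → E) (i : ι) (t : κ) (j : τ) :
    ‖R i t j‖ ≤ Real.sqrt (∑ i, ∑ t, ∑ j, ‖R i t j‖ ^ 2) := by
  apply Real.le_sqrt_of_sq_le
  calc ‖R i t j‖ ^ 2 ≤ ∑ j, ‖R i t j‖ ^ 2 :=
        Finset.single_le_sum (f := fun j => ‖R i t j‖ ^ 2)
          (fun _ _ => by positivity) (Finset.mem_univ j)
    _ ≤ ∑ t, ∑ j, ‖R i t j‖ ^ 2 :=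
        Finset.single_le_sum (f := fun t => ∑ j, ‖R i t j‖ ^ 2)
          (fun _ _ => by positivity) (Finset.mem_univ t)
    _ ≤ ∑ i, ∑ t, ∑ j, ‖R i t j‖ ^ 2 :=
        Finset.single_le_sum (f := fun i => ∑ t, ∑ j, ‖R i t j‖ ^ 2)
          (fun _ _ => by positivity) (Finset.mem_univ i)


/-- Bound for the term involving the derivative of the metric:
`|Σ α_i α_k N^t_{j̄k̄} R^i_{tj}| ≤ 4 K |α|² ‖R‖`. -/
theorem nijenhuis_derivative_metric_term_bound
    (K : ℝ) (hK : 0 ≤ K)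
    (a : Fin 2 → ℂ)
    (N : Fin 2 → Fin 2 → Fin 2 → ℂ)
    (hskew : ∀ i j k, N i j k = - N i k j)
    (hbd : ∀ i j k, ‖N i j k‖ ≤ K)
    (R : Fin 2 → Fin 2 → Fin 2 → ℂ) :
    ‖∑ i : Fin 2, ∑ t : Fin 2, ∑ j : Fin 2, ∑ k : Fin 2,
        a i * a k * N t j k * R i t j‖
      ≤ 4 * K * (∑ h : Fin 2, ‖a h‖ ^ 2)
          * Real.sqrt (∑ i : Fin 2, ∑ t : Fin 2, ∑ j : Fin 2, ‖R i t j‖ ^ 2) := by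
  set S := Real.sqrt (∑ i : Fin 2, ∑ t : Fin 2, ∑ j : Fin 2, ‖R i t j‖ ^ 2)
  have hS : 0 ≤ S := Real.sqrt_nonneg _
  have hterm : ∀ i t j k, ‖a i * a k * N t j k * R i t j‖
      ≤ if j = k then 0 else ‖a i‖ * ‖a k‖ * K * S := by
    intro i t j k
    split_ifs with hjk
    · subst hjk
      simp [self_eq_neg.mp (hskew t j j)]
    · rw [norm_mul, norm_mul, norm_mul]
      gcongr
      exacts [hbd t j k, norm_le_sqrt_sum_sq R i t j]
  calc ‖∑ i : Fin 2, ∑ t : Fin 2, ∑ j : Fin 2, ∑ k : Fin 2, a i * a k * N t j k * R i t j‖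
      ≤ ∑ i : Fin 2, ∑ t : Fin 2, ∑ j : Fin 2, ∑ k : Fin 2,
          if j = k then 0 else ‖a i‖ * ‖a k‖ * K * S :=
        norm_sum_le_of_le _ fun i _ => norm_sum_le_of_le _ fun t _ =>
          norm_sum_le_of_le _ fun j _ => norm_sum_le_of_le _ fun k _ => hterm i t j k
    _ = 2 * (‖a 0‖ + ‖a 1‖) ^ 2 * (K * S) := by
        simp [Fin.sum_univ_two]
        ring
    _ ≤ 4 * (‖a 0‖ ^ 2 + ‖a 1‖ ^ 2) * (K * S) := by
        gcongr ?_ * _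
        linarith [add_sq_le (a := ‖a 0‖) (b := ‖a 1‖)]
    _ = 4 * K * (∑ h : Fin 2, ‖a h‖ ^ 2) * S := by
        rw [Fin.sum_univ_two]
        ring
end
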